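/- arXiv:2006.03419 — 12 statements merged into one kernel-verified Lean document; each statement's English description precedes it below -/
import Mathlib

section
/- A quasi-pseudometric space (X,d) is sequentially weakly left K-complete if and only if it is sequentially left K-complete; that is, every weakly left K-Cauchy sequence in X is d-convergent if and only if every left K-Cauchy sequence in X is d-convergent. -/
/-- Romaguera: A quasi-pseudometric space is sequentially weakly left
K-complete iff it is sequentially left K-complete. -/
theorem stmt_4 {X : Type*} (d : X → X → ℝ)
    (hd0 : ∀ x y, 0 ≤ d x y) (hdxx : ∀ x, d x x = 0)
    (htri : ∀ x y z, d x z ≤ d x y + d y z) :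
    (∀ u : ℕ → X,
      (∀ ε > (0 : ℝ), ∃ n₀ : ℕ, ∀ n ≥ n₀, d (u n₀) (u n) < ε) →
      ∃ x : X, ∀ ε > (0 : ℝ), ∃ n₀ : ℕ, ∀ n ≥ n₀, d x (u n) < ε) ↔
    (∀ u : ℕ → X,
      (∀ ε > (0 : ℝ), ∃ n₀ : ℕ, ∀ k n, n₀ ≤ k → k ≤ n → d (u k) (u n) < ε) →
      ∃ x : X, ∀ ε > (0 : ℝ), ∃ n₀ : ℕ, ∀ n ≥ n₀, d x (u n) < ε) := by
  constructor
  · intro h u hu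
    refine h u fun ε hε => ?_
    obtain ⟨n₀, hn₀⟩ := hu ε hε
    exact ⟨n₀, fun n hn => hn₀ n₀ n le_rfl hn⟩
  · intro h u hu
    classical
    have hex (j : ℕ) : ∃ N, ∀ n ≥ N, d (u N) (u n) < 1 / ((j : ℝ) + 1) :=
      hu _ Nat.one_div_pos_of_nat
    -- Taking least witnesses makes the chosen indices monotone.
    let N (j : ℕ) : ℕ := Nat.find (hex j)
    have hN (j : ℕ) : ∀ n ≥ N j, d (u (N j)) (u n) < 1 / ((j : ℝ) + 1) := Nat.find_spec (hex j)
    have hmono {k m : ℕ} (hkm : k ≤ m) : N k ≤ N m :=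
      Nat.find_min' (hex k) fun n hn => (hN m n hn).trans_le (Nat.one_div_le_one_div hkm)
    obtain ⟨x, hx⟩ := h (fun j => u (N j)) fun ε hε => by
      obtain ⟨j, hj⟩ := exists_nat_one_div_lt hε
      exact ⟨j, fun k m hjk hkm =>
        (hN k _ (hmono hkm)).trans ((Nat.one_div_le_one_div hjk).trans_lt hj)⟩
    refine ⟨x, fun ε hε => ?_⟩
    obtain ⟨i, hi⟩ := hx (ε / 2) (half_pos hε)
    obtain ⟨j, hj⟩ := exists_nat_one_div_lt (half_pos hε)
    refine ⟨N (max i j), fun n hn => ?_⟩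
    have h₁ := hi (max i j) (le_max_left i j)
    have h₂ := hN (max i j) n hn
    have h₃ : 1 / (((max i j : ℕ) : ℝ) + 1) ≤ 1 / ((j : ℝ) + 1) :=
      Nat.one_div_le_one_div (le_max_right i j)
    linarith [htri x (u (N (max i j))) (u n)]
end

section
/- A quasi-pseudometric space (X,d) is sequentially left K-complete (every left K-Cauchy sequence is d-convergent) if and only if every sequence (x_n) in X with ∑_{n=1}^∞ d(x_n, x_{n+1}) < ∞ is d-convergent. -/
/-- The distance between two terms of a sequence is at most the sum of the consecutive distances
between them. -/
theorem le_sum_Ico_of_triangle {X : Type*} (d : X → X → ℝ) (hdxx : ∀ x, d x x = 0)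
    (htri : ∀ x y z, d x z ≤ d x y + d y z) (u : ℕ → X) {k n : ℕ} (hkn : k ≤ n) :
    d (u k) (u n) ≤ ∑ i ∈ Finset.Ico k n, d (u i) (u (i + 1)) := by
  induction n, hkn using Nat.le_induction with
  | base => simp [hdxx]
  | succ n hkn ih =>
    rw [Finset.sum_Ico_succ_top hkn]
    linarith [htri (u k) (u n) (u (n + 1))]

/-- A sequence with summable consecutive distances is left K-Cauchy. -/
theorem leftKCauchy_of_summable {X : Type*} (d : X → X → ℝ) (hd0 : ∀ x y, 0 ≤ d x y)
    (hdxx : ∀ x, d x x = 0) (htri : ∀ x y z, d x z ≤ d x y + d y z) (u : ℕ → X)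
    (hu : Summable fun n => d (u n) (u (n + 1))) :
    ∀ ε > (0 : ℝ), ∃ n₀ : ℕ, ∀ k n, n₀ ≤ k → k ≤ n → d (u k) (u n) < ε := by
  intro ε hε
  obtain ⟨n₀, hn₀⟩ := Metric.cauchySeq_iff.1 hu.hasSum.tendsto_sum_nat.cauchySeq ε hε
  refine ⟨n₀, fun k n hk hkn => ?_⟩
  have h := hn₀ n (hk.trans hkn) k hk
  rw [Real.dist_eq, ← Finset.sum_Ico_eq_sub _ hkn,
    abs_of_nonneg (Finset.sum_nonneg fun _ _ => hd0 _ _)] at h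
  exact (le_sum_Ico_of_triangle d hdxx htri u hkn).trans_lt h

/-- A left K-Cauchy sequence has, along some index sequence tending to infinity, summable
consecutive distances. -/
theorem exists_summable_comp_of_leftKCauchy {X : Type*} (d : X → X → ℝ)
    (hd0 : ∀ x y, 0 ≤ d x y) (u : ℕ → X)
    (hu : ∀ ε > (0 : ℝ), ∃ n₀ : ℕ, ∀ k n, n₀ ≤ k → k ≤ n → d (u k) (u n) < ε) :
    ∃ φ : ℕ → ℕ, Filter.Tendsto φ Filter.atTop Filter.atTop ∧
      Summable fun n => d (u (φ n)) (u (φ (n + 1))) := by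
  choose N hN using fun k : ℕ => hu ((1 / 2 : ℝ) ^ k) (by positivity)
  have hle (k : ℕ) : N k ≤ ∑ i ∈ Finset.range (k + 1), (N i + 1) := by
    rw [Finset.sum_range_succ]
    omega
  refine ⟨fun k => ∑ i ∈ Finset.range (k + 1), (N i + 1), ?_, ?_⟩
  · refine Filter.tendsto_atTop_mono (fun k => ?_) Filter.tendsto_id
    simp only [Finset.sum_add_distrib, Finset.sum_const, Finset.card_range, smul_eq_mul, id]
    omega
  · refine Summable.of_nonneg_of_le (fun _ => hd0 _ _)
      (fun k => (hN k _ _ (hle k) ?_).le) summable_geometric_two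
    beta_reduce
    rw [Finset.sum_range_succ _ (k + 1)]
    exact Nat.le_add_right _ _

/-- A quasi-pseudometric space is sequentially left K-complete iff every
sequence (x_n) with ∑ d(x_n, x_{n+1}) < ∞ is d-convergent. -/
theorem stmt_6 {X : Type*} (d : X → X → ℝ)
    (hd0 : ∀ x y, 0 ≤ d x y) (hdxx : ∀ x, d x x = 0)
    (htri : ∀ x y z, d x z ≤ d x y + d y z) :
    (∀ u : ℕ → X,
      (∀ ε > (0 : ℝ), ∃ n₀ : ℕ, ∀ k n, n₀ ≤ k → k ≤ n → d (u k) (u n) < ε) →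
      ∃ x : X, ∀ ε > (0 : ℝ), ∃ n₀ : ℕ, ∀ n ≥ n₀, d x (u n) < ε) ↔
    (∀ u : ℕ → X, Summable (fun n => d (u n) (u (n + 1))) →
      ∃ x : X, ∀ ε > (0 : ℝ), ∃ n₀ : ℕ, ∀ n ≥ n₀, d x (u n) < ε) := by
  constructor
  · exact fun h u hu => h u (leftKCauchy_of_summable d hd0 hdxx htri u hu)
  · intro h u hu
    obtain ⟨φ, hφ, hsum⟩ := exists_summable_comp_of_leftKCauchy d hd0 u hu
    obtain ⟨x, hx⟩ := h (fun n => u (φ n)) hsum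
    refine ⟨x, fun ε hε => ?_⟩
    obtain ⟨n₁, hn₁⟩ := hx (ε / 2) (half_pos hε)
    obtain ⟨n₂, hn₂⟩ := hu (ε / 2) (half_pos hε)
    obtain ⟨k, hk₁, hk₂⟩ :=
      ((Filter.eventually_ge_atTop n₁).and (hφ.eventually_ge_atTop n₂)).exists
    exact ⟨φ k, fun n hn => by linarith [htri x (u (φ k)) (u n), hn₁ k hk₁, hn₂ (φ k) n hk₂ hn]⟩
end

section
/- An asymmetric seminormed space (X,p) is sequentially left K-complete (with respect to the quasi-pseudometric d_p(x,y) = p(y−x)) if and only if every absolutely convergent series in X is convergent; that is, every left K-Cauchy sequence d_p-converges if and only if for every sequence (x_n) in X with ∑_{n=1}^∞ p(x_n) < ∞ the sequence of partial sums s_n = x_1 + ... + x_n d_p-converges to some x ∈ X. -/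
theorem sub_sum_range_le_of_subadditive {G : Type*} [AddCommGroup G] (p : G → ℝ)
    (hp : p 0 = 0) (hpt : ∀ x y, p (x + y) ≤ p x + p y) (x : ℕ → G) {k n : ℕ} (hkn : k ≤ n) :
    p (∑ i ∈ Finset.range n, x i - ∑ i ∈ Finset.range k, x i) ≤
      ∑ i ∈ Finset.range n, p (x i) - ∑ i ∈ Finset.range k, p (x i) := by
  rw [← Finset.sum_Ico_eq_sub _ hkn, ← Finset.sum_Ico_eq_sub _ hkn]
  exact Finset.le_sum_of_subadditive p hp.le hpt _ _


/-- An asymmetric seminormed space (X,p) is sequentially left K-complete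
(w.r.t. d_p(x,y) = p(y - x)) iff every absolutely convergent series is convergent. -/
theorem stmt_7 {X : Type*} [AddCommGroup X] [Module ℝ X] (p : X → ℝ)
    (hp0 : ∀ x, 0 ≤ p x)
    (hph : ∀ (α : ℝ) (x : X), 0 ≤ α → p (α • x) = α * p x)
    (hpt : ∀ x y, p (x + y) ≤ p x + p y) :
    (∀ u : ℕ → X,
      (∀ ε > (0 : ℝ), ∃ n₀ : ℕ, ∀ k n, n₀ ≤ k → k ≤ n → p (u n - u k) < ε) →
      ∃ x : X, ∀ ε > (0 : ℝ), ∃ n₀ : ℕ, ∀ n ≥ n₀, p (u n - x) < ε) ↔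
    (∀ x : ℕ → X, Summable (fun n => p (x n)) →
      ∃ s : X, ∀ ε > (0 : ℝ), ∃ n₀ : ℕ, ∀ n ≥ n₀,
        p ((∑ k ∈ Finset.range n, x k) - s) < ε) := by
  constructor
  · intro h x hx
    apply h
    intro ε hε
    obtain ⟨N, hN⟩ := Metric.cauchySeq_iff.1 hx.hasSum.tendsto_sum_nat.cauchySeq ε hε
    refine ⟨N, fun k n hk hkn => ?_⟩
    have hle := sub_sum_range_le_of_subadditive p (by simpa using hph 0 0 le_rfl) hpt x hkn
    have hlt := hN n (hk.trans hkn) k hk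
    rw [Real.dist_eq] at hlt
    exact (hle.trans (le_abs_self _)).trans_lt hlt
  · intro h u hu
    choose N hN using fun j : ℕ => hu ((1 / 2 : ℝ) ^ j) (by positivity)
    let φ : ℕ → ℕ := fun j => ∑ i ∈ Finset.range (j + 1), N i
    have hφN : ∀ j, N j ≤ φ j := fun j => by
      simp only [φ, Finset.sum_range_succ]
      omega
    have hφ : ∀ j, φ j ≤ φ (j + 1) := fun j => by
      simp only [φ, Finset.sum_range_succ _ (j + 1)]
      omega
    have hsum : Summable fun j => p (u (φ (j + 1)) - u (φ j)) :=
      Summable.of_nonneg_of_le (fun j => hp0 _)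
        (fun j => (hN j _ _ (hφN j) (hφ j)).le) summable_geometric_two
    obtain ⟨s, hs⟩ := h _ hsum
    refine ⟨s + u (φ 0), fun ε hε => ?_⟩
    obtain ⟨J, hJ⟩ := hs (ε / 2) (by positivity)
    obtain ⟨K, hK⟩ := exists_pow_lt_of_lt_one (half_pos hε) (by norm_num : (1 / 2 : ℝ) < 1)
    let j := max J K
    refine ⟨φ j, fun n hn => ?_⟩
    have hsub := hJ j (le_max_left _ _)
    rw [Finset.sum_range_sub (fun i => u (φ i))] at hsub
    have htail := hN j (φ j) n (hφN j) hn
    have hpow : (1 / 2 : ℝ) ^ j ≤ (1 / 2) ^ K :=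
      pow_le_pow_of_le_one (by norm_num) (by norm_num) (le_max_right _ _)
    have htri := hpt (u n - u (φ j)) (u (φ j) - u (φ 0) - s)
    rw [show u n - u (φ j) + (u (φ j) - u (φ 0) - s) = u n - (s + u (φ 0)) by abel] at htri
    linarith
end

section
/- A quasi-pseudometric space (X,d) is sequentially right K-complete (every right K-Cauchy sequence is d-convergent) if and only if every decreasing sequence of closed balls B_{d̄}[x_1,r_1] ⊇ B_{d̄}[x_2,r_2] ⊇ ... with r_n → 0 has nonempty intersection. If moreover the topology τ_d is Hausdorff, then this intersection contains exactly one element. -/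
open Filter Topology in
/-- A sequence dominated by radii tending to zero in the first argument converges to the point in
the topology generated by the balls of a function satisfying the triangle inequality. -/
theorem tendsto_nhds_of_dist_le {X : Type*} {d : X → X → ℝ}
    (htri : ∀ x y z, d x z ≤ d x y + d y z) {x : ℕ → X} {r : ℕ → ℝ} {y : X}
    (hy : ∀ n, d y (x n) ≤ r n) (hr : Tendsto r atTop (𝓝 0)) :
    Tendsto x atTop (@nhds X (TopologicalSpace.generateFrom
      {s : Set X | ∃ (x : X) (r : ℝ), 0 < r ∧ s = {y | d x y < r}}) y) := by
  rw [TopologicalSpace.tendsto_nhds_generateFrom_iff]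
  rintro s ⟨a, ρ, -, rfl⟩ hys
  have hpos : 0 < ρ - d a y := sub_pos.2 hys
  filter_upwards [hr.eventually_lt_const hpos] with n hn
  change d a (x n) < ρ
  linarith [htri a y (x n), hy n]

open Filter Topology in
/-- Centers of nested closed conjugate balls with vanishing radii form a right K-Cauchy sequence,
so in a sequentially right K-complete space the balls have a common point. -/
theorem exists_forall_dist_le_of_rightKComplete {X : Type*} {d : X → X → ℝ}
    (hdxx : ∀ x, d x x = 0) (htri : ∀ x y z, d x z ≤ d x y + d y z)
    (hcomplete : ∀ u : ℕ → X,
      (∀ ε > (0 : ℝ), ∃ n₀ : ℕ, ∀ k n, n₀ ≤ k → k ≤ n → d (u n) (u k) < ε) →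
      ∃ x : X, ∀ ε > (0 : ℝ), ∃ n₀ : ℕ, ∀ n ≥ n₀, d x (u n) < ε)
    {x : ℕ → X} {r : ℕ → ℝ} (hrpos : ∀ n, 0 < r n)
    (hsub : ∀ n, {y : X | d y (x (n + 1)) ≤ r (n + 1)} ⊆ {y : X | d y (x n) ≤ r n})
    (hr : Tendsto r atTop (𝓝 0)) : ∃ y, ∀ n, d y (x n) ≤ r n := by
  have hanti : Antitone fun n => {y : X | d y (x n) ≤ r n} := antitone_nat_of_succ_le hsub
  have hcenter : ∀ k n, k ≤ n → d (x n) (x k) ≤ r k := fun k n hkn =>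
    hanti hkn (show d (x n) (x n) ≤ r n from (hdxx _).trans_le (hrpos n).le)
  obtain ⟨y, hy⟩ := hcomplete x fun ε hε => by
    obtain ⟨n₀, hn₀⟩ := eventually_atTop.1 (hr.eventually_lt_const hε)
    exact ⟨n₀, fun k n hk hkn => (hcenter k n hkn).trans_lt (hn₀ k hk)⟩
  refine ⟨y, fun k => le_of_forall_pos_le_add fun ε hε => ?_⟩
  obtain ⟨n₀, hn₀⟩ := hy ε hε
  linarith [hn₀ (max n₀ k) (le_max_left _ _), hcenter k (max n₀ k) (le_max_right _ _),
    htri y (x (max n₀ k)) (x k)]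

open Filter Topology in
/-- If nested closed conjugate balls with vanishing radii have a common point, then every
right K-Cauchy sequence converges. -/
theorem exists_limit_of_nested_balls {X : Type*} {d : X → X → ℝ}
    (htri : ∀ x y z, d x z ≤ d x y + d y z)
    (hballs : ∀ (x : ℕ → X) (r : ℕ → ℝ), (∀ n, 0 < r n) →
      (∀ n, {y : X | d y (x (n + 1)) ≤ r (n + 1)} ⊆ {y : X | d y (x n) ≤ r n}) →
      Tendsto r atTop (𝓝 0) → (⋂ n, {y : X | d y (x n) ≤ r n}).Nonempty)
    {u : ℕ → X}
    (hu : ∀ ε > (0 : ℝ), ∃ n₀ : ℕ, ∀ k n, n₀ ≤ k → k ≤ n → d (u n) (u k) < ε) :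
    ∃ x : X, ∀ ε > (0 : ℝ), ∃ n₀ : ℕ, ∀ n ≥ n₀, d x (u n) < ε := by
  choose N hN using fun k : ℕ => hu ((1 / 2 : ℝ) ^ (k + 1)) (by positivity)
  let φ : ℕ → ℕ := fun k => ∑ i ∈ Finset.range (k + 1), (N i + 1)
  have hφsucc : ∀ k, φ (k + 1) = φ k + (N (k + 1) + 1) := fun k => Finset.sum_range_succ _ _
  have hφmono : StrictMono φ := strictMono_nat_of_lt_succ fun k => by rw [hφsucc]; omega
  have hNφ : ∀ k, N k ≤ φ k := fun k =>
    (Nat.le_succ _).trans (Finset.single_le_sum (f := fun i => N i + 1)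
      (fun _ _ => Nat.zero_le _) (Finset.self_mem_range_succ k))
  have hpow : Tendsto (fun k : ℕ => (1 / 2 : ℝ) ^ k) atTop (𝓝 0) :=
    tendsto_pow_atTop_nhds_zero_of_lt_one (by norm_num) (by norm_num)
  obtain ⟨z, hz⟩ := hballs (fun k => u (φ k)) (fun k => (1 / 2 : ℝ) ^ k)
    (fun k => by positivity) (fun k y hy => by
      simp only [Set.mem_ofPred_eq] at hy ⊢
      have hstep := hN k (φ k) (φ (k + 1)) (hNφ k) (hφmono.monotone k.le_succ)
      have htwo : (1 / 2 : ℝ) ^ (k + 1) = (1 / 2 : ℝ) ^ k / 2 := by ring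
      linarith [htri y (u (φ (k + 1))) (u (φ k))]) hpow
  simp only [Set.mem_iInter, Set.mem_ofPred_eq] at hz
  refine ⟨z, fun ε hε => ?_⟩
  obtain ⟨n₀, hn₀⟩ := hu (ε / 2) (half_pos hε)
  refine ⟨n₀, fun n hn => ?_⟩
  obtain ⟨k, hk, hnk⟩ :=
    ((hpow.eventually_lt_const (half_pos hε)).and (eventually_ge_atTop n)).exists
  linarith [htri z (u (φ k)) (u n), hz k, hn₀ n (φ k) hn (hnk.trans (hφmono.le_apply))]


open Filter in
/-- A quasi-pseudometric space is sequentially right K-complete iff every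
decreasing sequence of closed d̄-balls with radii tending to 0 has nonempty
intersection; if moreover τ_d is Hausdorff, this intersection is a singleton. -/
theorem stmt_9 {X : Type*} (d : X → X → ℝ)
    (hd0 : ∀ x y, 0 ≤ d x y) (hdxx : ∀ x, d x x = 0)
    (htri : ∀ x y z, d x z ≤ d x y + d y z)
    (τ : TopologicalSpace X)
    (hτ : τ = TopologicalSpace.generateFrom
      {s : Set X | ∃ (x : X) (r : ℝ), 0 < r ∧ s = {y | d x y < r}}) :
    ((∀ u : ℕ → X,
        (∀ ε > (0 : ℝ), ∃ n₀ : ℕ, ∀ k n, n₀ ≤ k → k ≤ n → d (u n) (u k) < ε) →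
        ∃ x : X, ∀ ε > (0 : ℝ), ∃ n₀ : ℕ, ∀ n ≥ n₀, d x (u n) < ε) ↔
      (∀ (x : ℕ → X) (r : ℕ → ℝ), (∀ n, 0 < r n) →
        (∀ n, {y : X | d y (x (n + 1)) ≤ r (n + 1)} ⊆ {y : X | d y (x n) ≤ r n}) →
        Tendsto r atTop (nhds 0) →
        (⋂ n, {y : X | d y (x n) ≤ r n}).Nonempty)) ∧
    (@T2Space X τ →
      (∀ u : ℕ → X,
        (∀ ε > (0 : ℝ), ∃ n₀ : ℕ, ∀ k n, n₀ ≤ k → k ≤ n → d (u n) (u k) < ε) →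
        ∃ x : X, ∀ ε > (0 : ℝ), ∃ n₀ : ℕ, ∀ n ≥ n₀, d x (u n) < ε) →
      ∀ (x : ℕ → X) (r : ℕ → ℝ), (∀ n, 0 < r n) →
        (∀ n, {y : X | d y (x (n + 1)) ≤ r (n + 1)} ⊆ {y : X | d y (x n) ≤ r n}) →
        Tendsto r atTop (nhds 0) →
        ∃! y : X, ∀ n, d y (x n) ≤ r n) := by
  subst hτ
  refine ⟨⟨fun hcomplete x r hrpos hsub hr => ?_, fun hballs u hu =>
    exists_limit_of_nested_balls htri hballs hu⟩, fun hT2 hcomplete x r hrpos hsub hr => ?_⟩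
  · obtain ⟨y, hy⟩ := exists_forall_dist_le_of_rightKComplete hdxx htri hcomplete hrpos hsub hr
    exact ⟨y, Set.mem_iInter.2 hy⟩
  · obtain ⟨y, hy⟩ := exists_forall_dist_le_of_rightKComplete hdxx htri hcomplete hrpos hsub hr
    exact ⟨y, hy, fun z hz => @tendsto_nhds_unique X ℕ (.generateFrom _) hT2 x atTop z y _
      (tendsto_nhds_of_dist_le htri hz hr) (tendsto_nhds_of_dist_le htri hy hr)⟩
end

section
/- For a quasi-metric space (X,d) the following are equivalent: (1) every left K-Cauchy sequence in X is d^s-convergent; (2) every left K-Cauchy net in X (indexed by a directed preordered set) is d^s-convergent. -/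
/-- If every index above `t` has an upper bound `k` satisfying `P n m k` beyond which the net `x`
varies by less than `1 / (n + 1)`, and left K-Cauchy sequences converge, then some convergent
sequence `x ∘ v` has consecutive indices related by `P`. -/
theorem exists_convergent_subsequence_of_step {X I : Type*} (d : X → X → ℝ)
    (hseq : ∀ u : ℕ → X,
      (∀ ε > (0 : ℝ), ∃ n₀ : ℕ, ∀ k n, n₀ ≤ k → k ≤ n → d (u k) (u n) < ε) →
      ∃ x : X, ∀ ε > (0 : ℝ), ∃ n₀ : ℕ, ∀ n ≥ n₀, max (d x (u n)) (d (u n) x) < ε)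
    (le : I → I → Prop) (hrefl : ∀ i, le i i)
    (htrans : ∀ ⦃i j k⦄, le i j → le j k → le i k) (x : I → X)
    (P : ℕ → I → I → Prop) (t : I)
    (hstep : ∀ (n : ℕ) (m : I), le t m → ∃ k, le m k ∧
      (∀ i j, le k i → le i j → d (x i) (x j) < 1 / ((n : ℝ) + 1)) ∧ P n m k) :
    ∃ (a : X) (v : ℕ → I), (∀ n, P n (v n) (v (n + 1))) ∧
      ∀ ε > (0 : ℝ), ∃ n₀ : ℕ, ∀ n ≥ n₀, max (d a (x (v n))) (d (x (v n)) a) < ε := by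
  choose! F hF using hstep
  let v : ℕ → I := fun n => Nat.rec t (fun n m => F n m) n
  have hv : ∀ n, v (n + 1) = F n (v n) := fun n => rfl
  have ht : ∀ n, le t (v n) := by
    intro n
    induction n with
    | zero => exact hrefl t
    | succ n ih => exact htrans ih (hF n _ ih).1
  have hmono : ∀ k n, k ≤ n → le (v k) (v n) := by
    intro k n hkn
    induction n, hkn using Nat.le_induction with
    | base => exact hrefl _
    | succ n _ ih => exact htrans ih (hF n _ (ht n)).1
  obtain ⟨a, ha⟩ := hseq (fun n => x (v n)) (by
    intro ε hε
    obtain ⟨N, hN⟩ := exists_nat_one_div_lt hε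
    exact ⟨N + 1, fun k n hk hkn =>
      ((hF N _ (ht N)).2.1 _ _ (hmono _ _ hk) (hmono _ _ hkn)).trans hN⟩)
  exact ⟨a, v, fun n => (hF n _ (ht n)).2.2, ha⟩

/-- If left K-Cauchy sequences converge, a left K-Cauchy net has arbitrarily late indices around
which it is also backward small. -/
theorem exists_backward_small_of_leftKCauchy {X I : Type*} (d : X → X → ℝ)
    (htri : ∀ x y z, d x z ≤ d x y + d y z)
    (hseq : ∀ u : ℕ → X,
      (∀ ε > (0 : ℝ), ∃ n₀ : ℕ, ∀ k n, n₀ ≤ k → k ≤ n → d (u k) (u n) < ε) →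
      ∃ x : X, ∀ ε > (0 : ℝ), ∃ n₀ : ℕ, ∀ n ≥ n₀, max (d x (u n)) (d (u n) x) < ε)
    (le : I → I → Prop) (hrefl : ∀ i, le i i)
    (htrans : ∀ ⦃i j k⦄, le i j → le j k → le i k)
    (hdir : ∀ i j : I, ∃ k : I, le i k ∧ le j k) (x : I → X)
    (hx : ∀ ε > (0 : ℝ), ∃ i₀ : I, ∀ i j : I, le i₀ i → le i j → d (x i) (x j) < ε)
    {ε : ℝ} (hε : 0 < ε) (t : I) :
    ∃ m, le t m ∧ ∀ j, le m j → d (x j) (x m) < ε := by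
  by_contra! hbad
  obtain ⟨c, hc⟩ := hx (ε / 2) (half_pos hε)
  obtain ⟨b, htb, hcb⟩ := hdir t c
  obtain ⟨a, v, hv, ha⟩ := exists_convergent_subsequence_of_step d hseq le hrefl htrans x
    (fun _ m k => ε / 2 ≤ d (x k) (x m)) b (by
      intro n m hm
      obtain ⟨j, hmj, hj⟩ := hbad m (htrans htb hm)
      obtain ⟨s, hs⟩ := hx (1 / ((n : ℝ) + 1)) Nat.one_div_pos_of_nat
      obtain ⟨k, hjk, hsk⟩ := hdir j s
      refine ⟨k, htrans hmj hjk, fun i l hki => hs i l (htrans hsk hki), ?_⟩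
      have h₁ := hc j k (htrans hcb (htrans hm hmj)) hjk
      have h₂ := htri (x j) (x k) (x m)
      linarith)
  obtain ⟨N, hN⟩ := ha (ε / 4) (by linarith)
  have h₁ := (max_lt_iff.1 (hN N le_rfl)).1
  have h₂ := (max_lt_iff.1 (hN (N + 1) (Nat.le_succ N))).2
  have h₃ := htri (x (v (N + 1))) a (x (v N))
  have h₄ := hv N
  linarith

/-- left Smyth completeness: In a quasi-metric space, every left K-Cauchy
sequence is d^s-convergent iff every left K-Cauchy net (indexed by a directed preordered
set) is d^s-convergent. -/
theorem stmt_10 {X : Type*} (d : X → X → ℝ)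
    (hd0 : ∀ x y, 0 ≤ d x y) (hdxx : ∀ x, d x x = 0)
    (htri : ∀ x y z, d x z ≤ d x y + d y z)
    (hsep : ∀ x y, d x y = 0 → d y x = 0 → x = y) :
    (∀ u : ℕ → X,
      (∀ ε > (0 : ℝ), ∃ n₀ : ℕ, ∀ k n, n₀ ≤ k → k ≤ n → d (u k) (u n) < ε) →
      ∃ x : X, ∀ ε > (0 : ℝ), ∃ n₀ : ℕ, ∀ n ≥ n₀,
        max (d x (u n)) (d (u n) x) < ε) ↔
    (∀ (I : Type*) (le : I → I → Prop), Reflexive le → Transitive le →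
      (∀ i j : I, ∃ k : I, le i k ∧ le j k) → Nonempty I →
      ∀ x : I → X,
      (∀ ε > (0 : ℝ), ∃ i₀ : I, ∀ i j : I, le i₀ i → le i j → d (x i) (x j) < ε) →
      ∃ a : X, ∀ ε > (0 : ℝ), ∃ i₀ : I, ∀ i : I, le i₀ i →
        max (d a (x i)) (d (x i) a) < ε) := by
  constructor
  · intro hseq I le hrefl htrans hdir hne x hx
    obtain ⟨t⟩ := hne
    obtain ⟨a, v, hv, ha⟩ := exists_convergent_subsequence_of_step d hseq le hrefl htrans x
      (fun (n : ℕ) _ k => ∀ j, le k j → max (d (x k) (x j)) (d (x j) (x k)) < 1 / ((n : ℝ) + 1)) t (by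
        intro n m _
        have hpos : (0 : ℝ) < 1 / ((n : ℝ) + 1) := Nat.one_div_pos_of_nat
        obtain ⟨s, hs⟩ := hx _ hpos
        obtain ⟨b, hmb, hsb⟩ := hdir m s
        obtain ⟨k, hbk, hk⟩ := exists_backward_small_of_leftKCauchy d htri hseq le hrefl htrans
          hdir x hx hpos b
        have hsk := htrans hsb hbk
        exact ⟨k, htrans hmb hbk, fun i j hki => hs i j (htrans hsk hki),
          fun j hkj => max_lt (hs k j hsk hkj) (hk j hkj)⟩)
    refine ⟨a, fun ε hε => ?_⟩
    obtain ⟨N, hN⟩ := ha (ε / 2) (half_pos hε)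
    obtain ⟨M, hM⟩ := exists_nat_one_div_lt (half_pos hε)
    let n := max N M
    have hn : 1 / ((n : ℝ) + 1) ≤ 1 / ((M : ℝ) + 1) :=
      Nat.one_div_le_one_div (le_max_right N M)
    refine ⟨v (n + 1), fun i hi => ?_⟩
    obtain ⟨h₁, h₂⟩ := max_lt_iff.1 (hN (n + 1) ((le_max_left N M).trans (Nat.le_succ n)))
    obtain ⟨h₃, h₄⟩ := max_lt_iff.1 (hv n i hi)
    have h₅ := htri a (x (v (n + 1))) (x i)
    have h₆ := htri (x i) (x (v (n + 1))) a
    exact max_lt (by linarith) (by linarith)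
  · intro hnet u hu
    obtain ⟨a, ha⟩ := hnet (ULift ℕ) (fun i j => i.down ≤ j.down) (fun i => le_refl i.down)
      (fun _ _ _ h₁ h₂ => le_trans h₁ h₂)
      (fun i j => ⟨⟨max i.down j.down⟩, le_max_left _ _, le_max_right _ _⟩) ⟨⟨0⟩⟩
      (fun i => u i.down) (by
        intro ε hε
        obtain ⟨N, hN⟩ := hu ε hε
        exact ⟨⟨N⟩, fun i j => hN i.down j.down⟩)
    refine ⟨a, fun ε hε => ?_⟩
    obtain ⟨N, hN⟩ := ha ε hε
    exact ⟨N.down, fun n hn => hN ⟨n⟩ hn⟩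
end

section
/- For a quasi-pseudometric space (X,d), the space is sequentially left K-complete (every left K-Cauchy sequence is d-convergent) if and only if every left K-Cauchy net in X (indexed by a directed preordered set) is d-convergent. -/
/-- In a directed preorder, every sequence is dominated termwise by an increasing sequence. -/
theorem exists_increasing_seq_above {I : Type*} {le : I → I → Prop} (hrefl : ∀ i, le i i)
    (htrans : ∀ i j k, le i j → le j k → le i k)
    (hdir : ∀ i j : I, ∃ k : I, le i k ∧ le j k) (f : ℕ → I) :
    ∃ g : ℕ → I, (∀ n, le (f n) (g n)) ∧ ∀ m n, m ≤ n → le (g m) (g n) := by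
  choose ub hleft hright using hdir
  refine ⟨fun n => Nat.rec (f 0) (fun n p => ub p (f (n + 1))) n, fun n => ?_, fun m n hmn => ?_⟩
  · cases n with
    | zero => exact hrefl _
    | succ n => exact hright _ _
  · induction hmn with
    | refl => exact hrefl _
    | step _ ih => exact htrans _ _ _ ih (hleft _ _)

/-- Romaguera: A quasi-pseudometric space is sequentially left K-complete
iff every left K-Cauchy net (indexed by a directed preordered set) is d-convergent. -/
theorem stmt_11 {X : Type*} (d : X → X → ℝ)
    (hd0 : ∀ x y, 0 ≤ d x y) (hdxx : ∀ x, d x x = 0)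
    (htri : ∀ x y z, d x z ≤ d x y + d y z) :
    (∀ u : ℕ → X,
      (∀ ε > (0 : ℝ), ∃ n₀ : ℕ, ∀ k n, n₀ ≤ k → k ≤ n → d (u k) (u n) < ε) →
      ∃ x : X, ∀ ε > (0 : ℝ), ∃ n₀ : ℕ, ∀ n ≥ n₀, d x (u n) < ε) ↔
    (∀ (I : Type*) (le : I → I → Prop), Reflexive le → Transitive le →
      (∀ i j : I, ∃ k : I, le i k ∧ le j k) → Nonempty I →
      ∀ x : I → X,
      (∀ ε > (0 : ℝ), ∃ i₀ : I, ∀ i j : I, le i₀ i → le i j → d (x i) (x j) < ε) →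
      ∃ a : X, ∀ ε > (0 : ℝ), ∃ i₀ : I, ∀ i : I, le i₀ i → d a (x i) < ε) := by
  constructor
  · intro hseq I le hrefl htrans hdir _ x hx
    choose f hf using fun n : ℕ => hx (1 / ((n : ℝ) + 1)) Nat.one_div_pos_of_nat
    obtain ⟨g, hfg, hg⟩ := exists_increasing_seq_above (fun i => hrefl i)
      (fun _ _ _ hij hjk => htrans hij hjk) hdir f
    have hfg' : ∀ m n, m ≤ n → le (f m) (g n) := fun m n hmn =>
      htrans (hfg m) (hg m n hmn)
    obtain ⟨a, ha⟩ := hseq (fun n => x (g n)) fun ε hε => by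
      obtain ⟨m, hm⟩ := exists_nat_one_div_lt hε
      exact ⟨m, fun k n hk hkn => (hf m _ _ (hfg' m k hk) (hg k n hkn)).trans hm⟩
    refine ⟨a, fun ε hε => ?_⟩
    obtain ⟨m, hm⟩ := exists_nat_one_div_lt (half_pos hε)
    obtain ⟨n₀, hn₀⟩ := ha (ε / 2) (half_pos hε)
    refine ⟨g (max m n₀), fun i hi => ?_⟩
    have h₁ := hn₀ (max m n₀) (le_max_right _ _)
    have h₂ := hf m _ _ (hfg' m _ (le_max_left m n₀)) hi
    linarith [htri a (x (g (max m n₀))) (x i)]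
  · intro hnet u hu
    obtain ⟨a, ha⟩ := hnet (ULift ℕ) (fun i j => i.down ≤ j.down) (fun _ => le_rfl)
      (fun _ _ _ hij hjk => le_trans hij hjk)
      (fun i j => ⟨⟨max i.down j.down⟩, le_max_left _ _, le_max_right _ _⟩) ⟨⟨0⟩⟩
      (fun i => u i.down) fun ε hε => by
        obtain ⟨n₀, hn₀⟩ := hu ε hε
        exact ⟨⟨n₀⟩, fun i j hi hij => hn₀ _ _ hi hij⟩
    refine ⟨a, fun ε hε => ?_⟩
    obtain ⟨i₀, hi₀⟩ := ha ε hε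
    exact ⟨i₀.down, fun n hn => hi₀ ⟨n⟩ hn⟩
end

section
/- For a quasi-pseudometric space (X,d), the space is sequentially left K-complete (every left K-Cauchy sequence is d-convergent) if and only if every left K-Cauchy filter on X is τ_d-convergent. -/
open Filter Topology

theorem nhds_generateFrom_balls {X : Type*} {d : X → X → ℝ} (hdxx : ∀ x, d x x = 0)
    (htri : ∀ x y z, d x z ≤ d x y + d y z) (F : Filter X) (x : X) :
    F ≤ @nhds X (TopologicalSpace.generateFrom
      {s : Set X | ∃ (x : X) (r : ℝ), 0 < r ∧ s = {y | d x y < r}}) x ↔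
    ∀ ε > (0 : ℝ), {y | d x y < ε} ∈ F := by
  rw [TopologicalSpace.nhds_generateFrom]
  simp only [le_iInf_iff, le_principal_iff]
  constructor
  · intro h ε hε
    exact h _ ⟨by simpa [hdxx x] using hε, x, ε, hε, rfl⟩
  · rintro h _ ⟨hx, z, r, -, rfl⟩
    have hzx : d z x < r := hx
    filter_upwards [h (r - d z x) (sub_pos.2 hzx)] with y hy
    have hxy : d x y < r - d z x := hy
    change d z y < r
    linarith [htri z x y]

theorem dist_lt_of_dist_succ_lt_half_pow {X : Type*} {d : X → X → ℝ} (hdxx : ∀ x, d x x = 0)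
    (htri : ∀ x y z, d x z ≤ d x y + d y z) {u : ℕ → X}
    (hu : ∀ n, d (u n) (u (n + 1)) < (1 / 2 : ℝ) ^ n) {k n : ℕ} (hkn : k ≤ n) :
    d (u k) (u n) < 2 * (1 / 2 : ℝ) ^ k := by
  have key : d (u k) (u n) ≤ 2 * (1 / 2 : ℝ) ^ k - 2 * (1 / 2 : ℝ) ^ n := by
    induction n, hkn using Nat.le_induction with
    | base => simp [hdxx]
    | succ n _ ih =>
      have h := htri (u k) (u n) (u (n + 1))
      have h' := hu n
      rw [pow_succ]
      linarith
  have : (0 : ℝ) < (1 / 2 : ℝ) ^ n := by positivity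
  linarith

/-- A left K-Cauchy filter carries a sequence with geometrically small steps whose balls belong
to the filter. -/
theorem exists_seq_of_leftKCauchy {X : Type*} {d : X → X → ℝ} (F : Filter X) [F.NeBot]
    (hF : ∀ ε > (0 : ℝ), ∃ A ∈ F, ∀ x ∈ A, {y : X | d x y < ε} ∈ F) :
    ∃ u : ℕ → X, (∀ n, {y | d (u n) y < (1 / 2 : ℝ) ^ n} ∈ F) ∧
      ∀ n, d (u n) (u (n + 1)) < (1 / 2 : ℝ) ^ n := by
  choose A hA hball using fun n : ℕ => hF ((1 / 2 : ℝ) ^ n) (by positivity)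
  obtain ⟨x₀, hx₀⟩ := F.nonempty_of_mem (hA 0)
  have step : ∀ n (x : A n), ∃ y : A (n + 1), d x y < (1 / 2 : ℝ) ^ n := fun n x => by
    obtain ⟨y, hy, hyA⟩ := F.nonempty_of_mem (inter_mem (hball n x x.2) (hA (n + 1)))
    exact ⟨⟨y, hyA⟩, hy⟩
  choose f hf using step
  let v : ∀ n, A n := fun n => Nat.rec (motive := fun n => A n) ⟨x₀, hx₀⟩ f n
  exact ⟨fun n => (v n : X), fun n => hball n _ (v n).2, fun n => hf n (v n)⟩

/-- Romaguera: A quasi-pseudometric space is sequentially left K-complete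
iff every left K-Cauchy filter on X is τ_d-convergent. -/
theorem stmt_12 {X : Type*} (d : X → X → ℝ)
    (hd0 : ∀ x y, 0 ≤ d x y) (hdxx : ∀ x, d x x = 0)
    (htri : ∀ x y z, d x z ≤ d x y + d y z)
    (τ : TopologicalSpace X)
    (hτ : τ = TopologicalSpace.generateFrom
      {s : Set X | ∃ (x : X) (r : ℝ), 0 < r ∧ s = {y | d x y < r}}) :
    (∀ u : ℕ → X,
      (∀ ε > (0 : ℝ), ∃ n₀ : ℕ, ∀ k n, n₀ ≤ k → k ≤ n → d (u k) (u n) < ε) →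
      ∃ x : X, ∀ ε > (0 : ℝ), ∃ n₀ : ℕ, ∀ n ≥ n₀, d x (u n) < ε) ↔
    (∀ F : Filter X, F.NeBot →
      (∀ ε > (0 : ℝ), ∃ A ∈ F, ∀ x ∈ A, {y : X | d x y < ε} ∈ F) →
      ∃ x : X, F ≤ @nhds X τ x) := by
  subst hτ
  simp only [nhds_generateFrom_balls hdxx htri]
  have small : ∀ ε > (0 : ℝ), ∃ N : ℕ, ∀ n ≥ N, 2 * (1 / 2 : ℝ) ^ n < ε := fun ε hε => by
    obtain ⟨N, hN⟩ := exists_pow_lt_of_lt_one (half_pos hε) (by norm_num : (1 / 2 : ℝ) < 1)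
    refine ⟨N, fun n hn => ?_⟩
    have : (1 / 2 : ℝ) ^ n ≤ (1 / 2 : ℝ) ^ N :=
      pow_le_pow_of_le_one (by norm_num) (by norm_num) hn
    linarith
  constructor
  · intro hseq F _ hF
    obtain ⟨u, hball, hstep⟩ := exists_seq_of_leftKCauchy F hF
    obtain ⟨x, hx⟩ := hseq u fun ε hε => by
      obtain ⟨N, hN⟩ := small ε hε
      exact ⟨N, fun k n hk hkn =>
        (dist_lt_of_dist_succ_lt_half_pow hdxx htri hstep hkn).trans (hN k hk)⟩
    refine ⟨x, fun ε hε => ?_⟩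
    obtain ⟨N, hN⟩ := small ε hε
    obtain ⟨M, hM⟩ := hx (ε / 2) (half_pos hε)
    filter_upwards [hball (max N M)] with y hy
    have h₁ := hN (max N M) (le_max_left _ _)
    have h₂ := hM (max N M) (le_max_right _ _)
    have h₃ : d (u (max N M)) y < (1 / 2 : ℝ) ^ max N M := hy
    change d x y < ε
    linarith [htri x (u (max N M)) y]
  · intro hfil u hu
    obtain ⟨x, hx⟩ := hfil (map u atTop) inferInstance fun ε hε => by
      obtain ⟨N, hN⟩ := hu ε hε
      refine ⟨u '' Set.Ici N, image_mem_map (Ici_mem_atTop N), ?_⟩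
      rintro _ ⟨k, hk, rfl⟩
      exact mem_map.2 (mem_of_superset (Ici_mem_atTop k) fun n hn => hN k n hk hn)
    exact ⟨x, fun ε hε => eventually_atTop.1 (mem_map.1 (hx ε hε))⟩
end

section
/- Let (X,d) be a quasi-metric space whose topology τ_d is Hausdorff. Then every left d-Cauchy sequence in X is d-convergent if and only if every left d-Cauchy filter on X is τ_d-convergent. -/
/-- In the topology generated by the balls of a quasi-metric, the balls centred at `x` form a
neighborhood basis at `x`. -/
theorem nhds_hasBasis_ball_of_quasiMetric {X : Type*} (d : X → X → ℝ)
    (hdxx : ∀ x, d x x = 0) (htri : ∀ x y z, d x z ≤ d x y + d y z)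
    (τ : TopologicalSpace X)
    (hτ : τ = TopologicalSpace.generateFrom
      {s : Set X | ∃ (x : X) (r : ℝ), 0 < r ∧ s = {y | d x y < r}}) (x : X) :
    (@nhds X τ x).HasBasis (fun r : ℝ => 0 < r) (fun r => {y | d x y < r}) := by
  have hbasis : TopologicalSpace.IsTopologicalBasis
      {s : Set X | ∃ (x : X) (r : ℝ), 0 < r ∧ s = {y | d x y < r}} := by
    refine ⟨?_, ?_, hτ⟩
    · rintro _ ⟨a, r, -, rfl⟩ _ ⟨b, s, -, rfl⟩ y ⟨hya, hyb⟩
      simp only [Set.mem_ofPred_eq] at hya hyb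
      refine ⟨_, ⟨y, min (r - d a y) (s - d b y), lt_min (by linarith) (by linarith), rfl⟩,
        by simp [hdxx, hya, hyb], ?_⟩
      intro z hz
      obtain ⟨h₁, h₂⟩ := lt_min_iff.1 (show d y z < _ from hz)
      exact ⟨show d a z < r by linarith [htri a y z], show d b z < s by linarith [htri b y z]⟩
    · exact Set.eq_univ_of_forall fun y => ⟨_, ⟨y, 1, one_pos, rfl⟩, by simp [hdxx]⟩
  refine ⟨fun t => ?_⟩
  rw [hbasis.mem_nhds_iff]
  constructor
  · rintro ⟨_, ⟨a, r, -, rfl⟩, hx, hsub⟩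
    have hx' : d a x < r := hx
    refine ⟨r - d a x, sub_pos.2 hx', fun z hz => hsub ?_⟩
    have hz' : d x z < r - d a x := hz
    exact show d a z < r by linarith [htri a x z]
  · rintro ⟨r, hr, hsub⟩
    exact ⟨_, ⟨x, r, hr, rfl⟩, by simpa [hdxx] using hr, hsub⟩

/-- Künzi: For a Hausdorff quasi-metric space (X,d): every left d-Cauchy
sequence is d-convergent iff every left d-Cauchy filter is τ_d-convergent. -/
theorem stmt_13 {X : Type*} (d : X → X → ℝ)
    (hd0 : ∀ x y, 0 ≤ d x y) (hdxx : ∀ x, d x x = 0)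
    (htri : ∀ x y z, d x z ≤ d x y + d y z)
    (hsep : ∀ x y, d x y = 0 → d y x = 0 → x = y)
    (τ : TopologicalSpace X)
    (hτ : τ = TopologicalSpace.generateFrom
      {s : Set X | ∃ (x : X) (r : ℝ), 0 < r ∧ s = {y | d x y < r}})
    (hT2 : @T2Space X τ) :
    (∀ u : ℕ → X,
      (∀ ε > (0 : ℝ), ∃ x : X, ∃ n₀ : ℕ, ∀ n ≥ n₀, d x (u n) < ε) →
      ∃ x : X, ∀ ε > (0 : ℝ), ∃ n₀ : ℕ, ∀ n ≥ n₀, d x (u n) < ε) ↔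
    (∀ F : Filter X, F.NeBot →
      (∀ ε > (0 : ℝ), ∃ x : X, {y : X | d x y < ε} ∈ F) →
      ∃ x : X, F ≤ @nhds X τ x) := by
  have hb := nhds_hasBasis_ball_of_quasiMetric d hdxx htri τ hτ
  have hlim (u : ℕ → X) (x : X) : Filter.Tendsto u Filter.atTop (nhds x) ↔
      ∀ ε > (0 : ℝ), ∃ n₀ : ℕ, ∀ n ≥ n₀, d x (u n) < ε := by
    simp [(hb x).tendsto_right_iff, Filter.eventually_atTop]
  simp only [← hlim]
  constructor
  · intro hseq F hF hcauchy
    choose c hc using fun n : ℕ => hcauchy (1 / ((n : ℝ) + 1)) Nat.one_div_pos_of_nat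
    let C (n : ℕ) : Set X := ⋂ k ∈ Set.Iic n, {y | d (c k) y < 1 / ((k : ℝ) + 1)}
    have hC (n : ℕ) : C n ∈ F := (Filter.biInter_mem (Set.finite_Iic n)).2 fun k _ => hc k
    have hconv (u : ℕ → X) (hu : ∀ n, u n ∈ C n) :
        ∃ x, Filter.Tendsto u Filter.atTop (nhds x) := by
      refine hseq u fun ε hε => ?_
      obtain ⟨k, hk⟩ := exists_nat_one_div_lt hε
      exact ⟨c k, k, fun n hn => (Set.mem_iInter₂.1 (hu n) k hn).trans hk⟩
    choose u hu using fun n => F.nonempty_of_mem (hC n)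
    obtain ⟨x, hx⟩ := hconv u hu
    refine ⟨x, (hb x).ge_iff.2 fun ε hε => ?_⟩
    suffices h : ∃ n, C n ⊆ {y | d x y < ε} from h.elim fun n hn => Filter.mem_of_superset (hC n) hn
    by_contra! hnot
    choose v hv hvx using fun n => Set.not_subset.1 (hnot n)
    -- Interleaving `u` and `v` forces them to have the same limit.
    obtain ⟨y, hy⟩ := hconv (fun n => if Even n then u n else v n) fun n => by
      split_ifs
      exacts [hu n, hv n]
    have heven : Filter.Tendsto (fun n : ℕ => 2 * n) Filter.atTop Filter.atTop :=
      Filter.tendsto_atTop_mono (fun n => by dsimp only [id]; omega) Filter.tendsto_id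
    have hxy : x = y := by
      refine tendsto_nhds_unique (hx.comp heven) ((hy.comp heven).congr fun n => ?_)
      simp
    subst hxy
    obtain ⟨n₀, hn₀⟩ := (hlim _ _).1 hy ε hε
    have h := hn₀ (2 * n₀ + 1) (by omega)
    rw [if_neg (by simp)] at h
    exact hvx _ h
  · intro hfilter u hu
    refine hfilter (Filter.map u Filter.atTop) inferInstance fun ε hε => ?_
    obtain ⟨x, n₀, hn₀⟩ := hu ε hε
    exact ⟨x, Filter.mem_map.2 (Filter.mem_atTop_sets.2 ⟨n₀, hn₀⟩)⟩
end

section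
/- Let (X,d) be a quasi-pseudometric space satisfying the R1 condition. Then every right K-Cauchy filter on X is τ_d-convergent if and only if every right K-Cauchy sequence in X is d-convergent. -/
open Filter Topology

/-- Dependent choice where the step may refer to all previously chosen values. -/
theorem exists_seq_of_forall_prefix {X : Type*} (Q : ℕ → X → Prop) (r : ℕ → X → X → Prop)
    (h : ∀ n (v : ℕ → X), (∀ k < n, Q k (v k)) → ∃ y, Q n y ∧ ∀ k < n, r k (v k) y) [Nonempty X] :
    ∃ u : ℕ → X, (∀ n, Q n (u n)) ∧ ∀ k n, k < n → r k (u k) (u n) := by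
  classical
  have h' : ∀ n (v : ℕ → X), ∃ y, (∀ k < n, Q k (v k)) → Q n y ∧ ∀ k < n, r k (v k) y := by
    intro n v
    by_cases hv : ∀ k < n, Q k (v k)
    · obtain ⟨y, hy⟩ := h n v hv
      exact ⟨y, fun _ => hy⟩
    · exact ⟨Classical.arbitrary X, fun hv' => absurd hv' hv⟩
  choose g hg using h'
  let F : ∀ n, (∀ k, k < n → X) → X := fun n v =>
    g n fun k => if hk : k < n then v k hk else Classical.arbitrary X
  let u : ℕ → X := Nat.lt_wfRel.wf.fix F
  have hu : ∀ n, u n = g n fun k => if k < n then u k else Classical.arbitrary X := by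
    intro n
    have := Nat.lt_wfRel.wf.fix_eq F n
    simpa only [F, dite_eq_ite] using this
  have key : ∀ n, Q n (u n) ∧ ∀ k < n, r k (u k) (u n) := by
    intro n
    induction n using Nat.strong_induction_on with
    | _ n ih =>
      have := hg n (fun k => if k < n then u k else Classical.arbitrary X) (by
        intro k hk
        simpa only [if_pos hk] using (ih k hk).1)
      rw [← hu n] at this
      refine ⟨this.1, fun k hk => ?_⟩
      simpa only [if_pos hk] using this.2 k hk
  exact ⟨u, fun n => (key n).1, fun k n hkn => (key n).2 k hkn⟩

/-- In the topology generated by the balls of a quasi-pseudometric, the balls centred at a point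
form a basis of its neighbourhood filter. -/
theorem nhds_hasBasis_of_quasiPseudometric {X : Type*} (d : X → X → ℝ)
    (hdxx : ∀ x, d x x = 0) (htri : ∀ x y z, d x z ≤ d x y + d y z)
    [τ : TopologicalSpace X]
    (hτ : τ = TopologicalSpace.generateFrom
      {s : Set X | ∃ (x : X) (r : ℝ), 0 < r ∧ s = {y | d x y < r}}) (x : X) :
    (𝓝 x).HasBasis (fun r : ℝ => 0 < r) fun r => {y | d x y < r} := by
  have hball : ∀ z r, 0 < r → IsOpen {y | d z y < r} := by
    intro z r hr
    rw [hτ]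
    exact TopologicalSpace.isOpen_generateFrom_of_mem ⟨z, r, hr, rfl⟩
  have hopen : ∀ U : Set X, IsOpen U → ∀ z ∈ U, ∃ r > 0, {y | d z y < r} ⊆ U := by
    intro U hU
    rw [hτ] at hU
    induction hU with
    | basic s hs =>
      obtain ⟨c, r, -, rfl⟩ := hs
      intro z hz
      refine ⟨r - d c z, sub_pos.2 hz, fun y hy => ?_⟩
      have hy' : d z y < r - d c z := hy
      have := htri c z y
      show d c y < r
      linarith
    | univ => exact fun z _ => ⟨1, one_pos, Set.subset_univ _⟩
    | inter s t _ _ hs ht =>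
      rintro z ⟨hzs, hzt⟩
      obtain ⟨r, hr, hrs⟩ := hs z hzs
      obtain ⟨q, hq, hqt⟩ := ht z hzt
      exact ⟨min r q, lt_min hr hq, fun y hy =>
        ⟨hrs (lt_of_lt_of_le hy (min_le_left r q)), hqt (lt_of_lt_of_le hy (min_le_right r q))⟩⟩
    | sUnion S _ ih =>
      rintro z ⟨s, hs, hzs⟩
      obtain ⟨r, hr, hrs⟩ := ih s hs z hzs
      exact ⟨r, hr, hrs.trans (Set.subset_sUnion_of_mem hs)⟩
  refine ⟨fun s => ⟨fun hs => ?_, ?_⟩⟩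
  · obtain ⟨U, hUs, hU, hx⟩ := mem_nhds_iff.1 hs
    obtain ⟨r, hr, hrU⟩ := hopen U hU x hx
    exact ⟨r, hr, hrU.trans hUs⟩
  · rintro ⟨r, hr, hrs⟩
    refine mem_nhds_iff.2 ⟨_, hrs, hball x r hr, ?_⟩
    simpa only [Set.mem_ofPred_eq, hdxx] using hr

/-- In a right K-sequentially complete R1 quasi-pseudometric space, every right K-Cauchy filter
converges. -/
theorem exists_le_nhds_of_rightKCauchy {X : Type*} [TopologicalSpace X] [R1Space X]
    {d : X → X → ℝ} (hdxx : ∀ x, d x x = 0) (htri : ∀ x y z, d x z ≤ d x y + d y z)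
    (hb : ∀ x, (𝓝 x).HasBasis (fun r : ℝ => 0 < r) fun r => {y | d x y < r})
    (hseq : ∀ u : ℕ → X,
      (∀ ε > (0 : ℝ), ∃ n₀ : ℕ, ∀ k n, n₀ ≤ k → k ≤ n → d (u n) (u k) < ε) →
      ∃ x : X, Tendsto u atTop (𝓝 x))
    {F : Filter X} [F.NeBot]
    (hF : ∀ ε > (0 : ℝ), ∃ A ∈ F, ∀ x ∈ A, {y : X | d y x < ε} ∈ F) :
    ∃ x : X, F ≤ 𝓝 x := by
  have : Nonempty X := F.nonempty_of_neBot
  have hpos : ∀ n : ℕ, (0 : ℝ) < 1 / (n + 1) := fun n => Nat.one_div_pos_of_nat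
  choose A hAF hA using fun n : ℕ => hF (1 / (n + 1)) (hpos n)
  have exists_lim : ∀ P : ℕ → Set X, (∀ n, ∃ᶠ y in F, y ∈ P n) →
      ∃ (u : ℕ → X) (x : X), (∀ n, u n ∈ A n) ∧ (∀ n, u n ∈ P n) ∧ Tendsto u atTop (𝓝 x) := by
    intro P hP
    obtain ⟨u, hu, hlt⟩ := exists_seq_of_forall_prefix (fun n y => y ∈ A n ∧ y ∈ P n)
      (fun k x y => d y x < 1 / (k + 1)) (by
        intro n v hv
        have h1 : ∀ᶠ y in F, ∀ k ∈ Set.Iio n, d y (v k) < 1 / (k + 1) :=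
          (eventually_all_finite (Set.finite_Iio n)).2 fun k hk => hA k _ (hv k hk).1
        obtain ⟨y, hyP, hyA, hy⟩ := ((hP n).and_eventually
          ((eventually_mem_set.2 (hAF n)).and h1)).exists
        exact ⟨y, ⟨hyA, hyP⟩, hy⟩)
    obtain ⟨x, hx⟩ := hseq u (by
      intro ε hε
      obtain ⟨n₀, hn₀⟩ := exists_nat_one_div_lt hε
      refine ⟨n₀, fun k n hk hkn => ?_⟩
      rcases hkn.eq_or_lt with rfl | hkn
      · rwa [hdxx]
      · exact (hlt k n hkn).trans_le ((Nat.one_div_le_one_div hk).trans hn₀.le))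
    exact ⟨u, x, fun n => (hu n).1, fun n => (hu n).2, hx⟩
  have tendsto_of_near : ∀ (u v : ℕ → X) (y : X), Tendsto v atTop (𝓝 y) →
      (∀ n : ℕ, d (v n) (u n) < 1 / (n + 1)) → Tendsto u atTop (𝓝 y) := by
    intro u v y hv huv
    refine (hb y).tendsto_right_iff.2 fun ε hε => ?_
    filter_upwards [(hb y).tendsto_right_iff.1 hv (ε / 2) (half_pos hε),
      tendsto_one_div_add_atTop_nhds_zero_nat.eventually_lt_const (half_pos hε)] with n h1 h2
    have h1' : d y (v n) < ε / 2 := h1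
    have := htri y (v n) (u n)
    have := huv n
    show d y (u n) < ε
    linarith
  obtain ⟨u, x, huA, -, hux⟩ := exists_lim (fun _ => Set.univ) fun _ =>
    Eventually.frequently (Eventually.of_forall fun _ => Set.mem_univ _)
  refine ⟨x, (hb x).ge_iff.2 fun ε hε => ?_⟩
  by_contra hnot
  obtain ⟨v, x', hvA, hvP, hvx'⟩ := exists_lim (fun _ => {y | ¬ d x y < ε}) fun _ =>
    not_eventually.1 fun h => hnot h
  obtain ⟨w, z, -, hwP, hwz⟩ := exists_lim
    (fun n => {y | d y (u n) < 1 / (n + 1) ∧ d y (v n) < 1 / (n + 1)}) fun n =>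
      ((eventually_mem_set.2 (hA n _ (huA n))).and
        (eventually_mem_set.2 (hA n _ (hvA n)))).frequently
  have hxz : Inseparable x z :=
    tendsto_nhds_unique_inseparable hux (tendsto_of_near u w z hwz fun n => (hwP n).1)
  have hvx : Tendsto v atTop (𝓝 x) := by
    rw [hxz.nhds_eq]
    exact tendsto_of_near v w z hwz fun n => (hwP n).2
  obtain ⟨n, hn⟩ := ((hb x).tendsto_right_iff.1 hvx ε hε).exists
  exact hvP n hn


/-- In an R1 quasi-pseudometric space, every right K-Cauchy filter is
τ_d-convergent iff every right K-Cauchy sequence is d-convergent. -/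
theorem stmt_15 {X : Type*} (d : X → X → ℝ)
    (hd0 : ∀ x y, 0 ≤ d x y) (hdxx : ∀ x, d x x = 0)
    (htri : ∀ x y z, d x z ≤ d x y + d y z)
    (τ : TopologicalSpace X)
    (hτ : τ = TopologicalSpace.generateFrom
      {s : Set X | ∃ (x : X) (r : ℝ), 0 < r ∧ s = {y | d x y < r}})
    (hR1 : ∀ x y : X, @closure X τ {x} ≠ @closure X τ {y} →
      ∃ U V : Set X, @IsOpen X τ U ∧ @IsOpen X τ V ∧ Disjoint U V ∧ x ∈ U ∧ y ∈ V) :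
    (∀ F : Filter X, F.NeBot →
      (∀ ε > (0 : ℝ), ∃ A ∈ F, ∀ x ∈ A, {y : X | d y x < ε} ∈ F) →
      ∃ x : X, F ≤ @nhds X τ x) ↔
    (∀ u : ℕ → X,
      (∀ ε > (0 : ℝ), ∃ n₀ : ℕ, ∀ k n, n₀ ≤ k → k ≤ n → d (u n) (u k) < ε) →
      ∃ x : X, ∀ ε > (0 : ℝ), ∃ n₀ : ℕ, ∀ n ≥ n₀, d x (u n) < ε) := by
  have hb := nhds_hasBasis_of_quasiPseudometric d hdxx htri hτ
  have hlim : ∀ (u : ℕ → X) (x : X), Tendsto u atTop (𝓝 x) ↔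
      ∀ ε > (0 : ℝ), ∃ n₀ : ℕ, ∀ n ≥ n₀, d x (u n) < ε := fun u x => by
    simp only [(hb x).tendsto_right_iff, eventually_atTop, Set.mem_ofPred_eq, gt_iff_lt]
  constructor
  · intro h u hu
    obtain ⟨x, hx⟩ := h (map u atTop) inferInstance (by
      intro ε hε
      obtain ⟨n₀, hn₀⟩ := hu ε hε
      refine ⟨u '' Set.Ici n₀, image_mem_map (Ici_mem_atTop n₀), ?_⟩
      rintro _ ⟨k, hk, rfl⟩
      exact mem_map.2 (mem_of_superset (Ici_mem_atTop k) fun n hn => hn₀ k n hk hn))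
    exact ⟨x, (hlim u x).1 hx⟩
  · intro h F hFne hF
    have : R1Space X := ⟨fun x y => by
      by_cases hxy : closure {x} = closure {y}
      · exact Or.inl (inseparable_iff_closure_eq.2 hxy).specializes
      · obtain ⟨U, V, hU, hV, hUV, hx, hy⟩ := hR1 x y hxy
        exact Or.inr (disjoint_of_disjoint_of_mem hUV (hU.mem_nhds hx) (hV.mem_nhds hy))⟩
    exact exists_le_nhds_of_rightKCauchy hdxx htri hb
      (fun u hu => (h u hu).imp fun x hx => (hlim u x).2 hx) hF
end

section
/- There exists a quasi-metric space (X,d) whose topology τ_d is T1 such that every right K-Cauchy sequence in X is d-convergent, yet there exists a right K-Cauchy net in X, indexed by a directed partially ordered set, which is not d-convergent. -/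
/-- Points are pairs `(A, k)` with `A` a countable set of reals and `k : ℕ`. The weight of
`(A, k)` is `1 / k` for `k ≠ 0`, and the points `(A, 0)` serve as limits. -/
abbrev CountablePoint : Type := {s : Set ℝ // s.Countable} × ℕ

namespace CountablePoint

open Classical in
/-- The distance from `x` to `y ≠ x` is the weight of `y` if `y` has nonzero level and its set is
contained in that of `x`, and `1` otherwise. -/
noncomputable def qdist (x y : CountablePoint) : ℝ :=
  if x = y then 0 else if y.1 ≤ x.1 ∧ 0 < y.2 then 1 / (y.2 : ℝ) else 1

lemma qdist_self (x : CountablePoint) : qdist x x = 0 := by simp [qdist]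

lemma qdist_pos {x y : CountablePoint} (h : x ≠ y) : 0 < qdist x y := by
  unfold qdist
  rw [if_neg h]
  split_ifs with h'
  · have := h'.2
    positivity
  · exact one_pos

lemma qdist_nonneg (x y : CountablePoint) : 0 ≤ qdist x y := by
  rcases eq_or_ne x y with rfl | h
  · exact (qdist_self x).ge
  · exact (qdist_pos h).le

lemma qdist_of_le {x y : CountablePoint} (hne : x ≠ y) (h : y.1 ≤ x.1) (hy : 0 < y.2) :
    qdist x y = 1 / (y.2 : ℝ) := by
  rw [qdist, if_neg hne, if_pos ⟨h, hy⟩]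

lemma qdist_le_of_le {x y : CountablePoint} (h : y.1 ≤ x.1) (hy : 0 < y.2) :
    qdist x y ≤ 1 / (y.2 : ℝ) := by
  rcases eq_or_ne x y with rfl | hne
  · rw [qdist_self]
    positivity
  · exact (qdist_of_le hne h hy).le

lemma qdist_le_one (x y : CountablePoint) : qdist x y ≤ 1 := by
  unfold qdist
  split_ifs with h h'
  · exact zero_le_one
  · have : (1 : ℝ) ≤ y.2 := by exact_mod_cast h'.2
    exact (div_le_one (by linarith)).2 this
  · exact le_rfl

lemma le_of_qdist_lt_one {x y : CountablePoint} (h : qdist x y < 1) : y.1 ≤ x.1 := by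
  unfold qdist at h
  split_ifs at h with h₁ h₂
  · exact h₁ ▸ le_rfl
  · exact h₂.1
  · exact absurd h (lt_irrefl _)

lemma level_pos_of_qdist_lt_one {x y : CountablePoint} (hne : x ≠ y) (h : qdist x y < 1) :
    0 < y.2 := by
  rw [qdist, if_neg hne] at h
  split_ifs at h with h₂
  · exact h₂.2
  · exact absurd h (lt_irrefl _)

lemma qdist_triangle (x y z : CountablePoint) : qdist x z ≤ qdist x y + qdist y z := by
  have hxy := qdist_nonneg x y
  have hyz := qdist_nonneg y z
  have hxz := qdist_le_one x z
  rcases eq_or_ne y z with rfl | hne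
  · linarith
  by_cases h₁ : qdist x y < 1
  · by_cases h₂ : qdist y z < 1
    · have hz := level_pos_of_qdist_lt_one hne h₂
      have hle := le_of_qdist_lt_one h₂
      rw [qdist_of_le hne hle hz]
      linarith [qdist_le_of_le (hle.trans (le_of_qdist_lt_one h₁)) hz]
    · linarith
  · linarith

/-- Right K-Cauchy sequences converge: an eventually constant one to its value, any other one to
the union of its sets at level `0`. -/
lemma exists_limit_of_rightKCauchy (u : ℕ → CountablePoint)
    (hu : ∀ ε > (0 : ℝ), ∃ n₀ : ℕ, ∀ k n, n₀ ≤ k → k ≤ n → qdist (u n) (u k) < ε) :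
    ∃ x, ∀ ε > (0 : ℝ), ∃ n₀ : ℕ, ∀ n ≥ n₀, qdist x (u n) < ε := by
  by_cases hconst : ∃ N, ∀ n ≥ N, u n = u N
  · obtain ⟨N, hN⟩ := hconst
    refine ⟨u N, fun ε hε => ⟨N, fun n hn => ?_⟩⟩
    rwa [hN n hn, qdist_self]
  push Not at hconst
  refine ⟨(⟨⋃ n, (u n).1.1, Set.countable_iUnion fun n => (u n).1.2⟩, 0), fun ε hε => ?_⟩
  obtain ⟨n₀, hn₀⟩ := hu (min ε 1) (by positivity)
  refine ⟨n₀, fun k hk => ?_⟩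
  obtain ⟨n, hkn, hne⟩ := hconst k
  have hlt := hn₀ k n hk hkn
  have hlt₁ := hlt.trans_le (min_le_right _ _)
  have hpos := level_pos_of_qdist_lt_one hne hlt₁
  rw [qdist_of_le hne (le_of_qdist_lt_one hlt₁) hpos] at hlt
  exact (qdist_le_of_le (Set.subset_iUnion (fun n => (u n).1.1) k) hpos).trans_lt
    (hlt.trans_le (min_le_left _ _))

lemma t1Space_of_balls {X : Type*} {d : X → X → ℝ} (hself : ∀ x, d x x = 0)
    (hpos : ∀ x y, x ≠ y → 0 < d x y) :
    @T1Space X (TopologicalSpace.generateFrom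
      {s : Set X | ∃ (x : X) (r : ℝ), 0 < r ∧ s = {y | d x y < r}}) := by
  let _ : TopologicalSpace X := TopologicalSpace.generateFrom
    {s : Set X | ∃ (x : X) (r : ℝ), 0 < r ∧ s = {y | d x y < r}}
  rw [t1Space_iff_exists_open]
  intro x y hxy
  refine ⟨{z | d x z < d x y}, .basic _ ⟨x, _, hpos x y hxy, rfl⟩, ?_, ?_⟩
  · simpa [hself] using hpos x y hxy
  · simp

/-- The net of all points of nonzero level. -/
def net (i : CountablePoint) : CountablePoint := (i.1, i.2 + 1)

lemma rightKCauchy_net (ε : ℝ) (hε : 0 < ε) :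
    ∃ i₀ : CountablePoint, ∀ i j, i₀ ≤ i → i ≤ j → qdist (net j) (net i) < ε := by
  obtain ⟨N, hN⟩ := exists_nat_one_div_lt hε
  refine ⟨(⟨∅, Set.countable_empty⟩, N), fun i j hi hij => ?_⟩
  refine (qdist_le_of_le (x := net j) (y := net i) hij.1 (Nat.succ_pos _)).trans_lt (lt_of_le_of_lt ?_ hN)
  have : (N : ℝ) ≤ i.2 := by exact_mod_cast hi.2
  simp only [net, Nat.cast_add, Nat.cast_one]
  gcongr

lemma not_exists_limit_net :
    ¬ ∃ a, ∀ ε > (0 : ℝ), ∃ i₀ : CountablePoint, ∀ i, i₀ ≤ i → qdist a (net i) < ε := by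
  rintro ⟨a, ha⟩
  obtain ⟨i₀, h⟩ := ha 1 one_pos
  obtain ⟨t, ht⟩ : ∃ t, t ∉ a.1.1 := by
    by_contra! hall
    exact Set.not_countable_univ (α := ℝ) (a.1.2.mono fun t _ => hall t)
  have hle : i₀ ≤ (⟨insert t i₀.1.1, i₀.1.2.insert t⟩, i₀.2) :=
    ⟨Set.subset_insert t i₀.1.1, le_rfl⟩
  exact ht (le_of_qdist_lt_one (h _ hle) (Set.mem_insert t i₀.1.1))

end CountablePoint

/-- Stoltenberg's example: There is a T1 quasi-metric space that is
sequentially right K-complete but has a right K-Cauchy net, indexed by a directed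
partially ordered set, that is not d-convergent. -/
theorem stmt_16 :
    ∃ (X : Type) (d : X → X → ℝ) (τ : TopologicalSpace X),
      (∀ x y, 0 ≤ d x y) ∧ (∀ x, d x x = 0) ∧
      (∀ x y z, d x z ≤ d x y + d y z) ∧
      (∀ x y, d x y = 0 → d y x = 0 → x = y) ∧
      τ = TopologicalSpace.generateFrom
        {s : Set X | ∃ (x : X) (r : ℝ), 0 < r ∧ s = {y | d x y < r}} ∧
      @T1Space X τ ∧
      (∀ u : ℕ → X,
        (∀ ε > (0 : ℝ), ∃ n₀ : ℕ, ∀ k n, n₀ ≤ k → k ≤ n → d (u n) (u k) < ε) →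
        ∃ x : X, ∀ ε > (0 : ℝ), ∃ n₀ : ℕ, ∀ n ≥ n₀, d x (u n) < ε) ∧
      ∃ (I : Type) (le : I → I → Prop),
        Reflexive le ∧ Transitive le ∧ AntiSymmetric le ∧
        (∀ i j : I, ∃ k : I, le i k ∧ le j k) ∧ Nonempty I ∧
        ∃ x : I → X,
          (∀ ε > (0 : ℝ), ∃ i₀ : I, ∀ i j : I, le i₀ i → le i j →
            d (x j) (x i) < ε) ∧
          ¬ ∃ a : X, ∀ ε > (0 : ℝ), ∃ i₀ : I, ∀ i : I, le i₀ i → d a (x i) < ε := by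
  open CountablePoint in
  refine ⟨CountablePoint, qdist, _, qdist_nonneg, qdist_self, qdist_triangle, fun x y h _ => ?_,
    rfl, t1Space_of_balls qdist_self fun _ _ => qdist_pos, exists_limit_of_rightKCauchy,
    CountablePoint, (· ≤ ·), fun _ => le_rfl, fun _ _ _ => le_trans, fun _ _ => le_antisymm,
    fun i j => ?_, ⟨(⟨∅, Set.countable_empty⟩, 0)⟩, net, rightKCauchy_net, not_exists_limit_net⟩
  · by_contra hne
    exact (qdist_pos hne).ne' h
  · exact ⟨(⟨i.1.1 ∪ j.1.1, i.1.2.union j.1.2⟩, max i.2 j.2),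
      ⟨Set.subset_union_left, le_max_left _ _⟩, ⟨Set.subset_union_right, le_max_right _ _⟩⟩
end

section
/- Let (X,d) be a T1 quasi-metric space. Then every right K-Cauchy sequence in X is d-convergent if and only if every strongly Stoltenberg-Cauchy net in X (indexed by a directed preordered set) is d-convergent. -/
/-- In a topology generated by the balls of a T1 quasi-metric, distance zero in one direction
already forces equality. -/
theorem eq_of_quasiMetric_eq_zero {X : Type*} (d : X → X → ℝ)
    (htri : ∀ x y z, d x z ≤ d x y + d y z) (τ : TopologicalSpace X)
    (hτ : τ = TopologicalSpace.generateFrom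
      {s : Set X | ∃ (x : X) (r : ℝ), 0 < r ∧ s = {y | d x y < r}})
    (hT1 : @T1Space X τ) {x y : X} (hxy : d x y = 0) : x = y := by
  have mem_of_open : ∀ U : Set X, @IsOpen X τ U → x ∈ U → y ∈ U := by
    intro U hU
    rw [hτ] at hU
    induction hU with
    | basic s hs =>
      obtain ⟨z, r, -, rfl⟩ := hs
      intro hx
      have := htri z x y
      simp only [Set.mem_ofPred_eq] at hx ⊢
      linarith
    | univ => exact fun _ => trivial
    | inter s t _ _ hs ht => exact fun hx => ⟨hs hx.1, ht hx.2⟩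
    | sUnion S _ ih => exact fun ⟨s, hs, hx⟩ => ⟨s, hs, ih s hs hx⟩
  by_contra hne
  exact mem_of_open {y}ᶜ (isOpen_compl_singleton (X := X)) hne rfl

/-- In a directed preorder, countably many points can be dominated by a monotone sequence. -/
theorem exists_monotone_dominating_seq {I : Type*} (le : I → I → Prop) (hrefl : ∀ i, le i i)
    (htrans : ∀ ⦃i j k⦄, le i j → le j k → le i k)
    (hdir : ∀ i j : I, ∃ k : I, le i k ∧ le j k) (f : ℕ → I) :
    ∃ g : ℕ → I, (∀ m n, m ≤ n → le (g m) (g n)) ∧ ∀ n, le (f n) (g n) := by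
  choose b hb using hdir
  let g : ℕ → I := fun n => Nat.rec (f 0) (fun n i => b i (f (n + 1))) n
  refine ⟨g, fun m n hmn => ?_, fun n => ?_⟩
  · induction n, hmn using Nat.le_induction with
    | base => exact hrefl _
    | succ n _ ih => exact htrans ih (hb (g n) (f (n + 1))).1
  · cases n with
    | zero => exact hrefl _
    | succ n => exact (hb (g n) (f (n + 1))).2

/-- A T1 quasi-metric space is sequentially right K-complete iff every
strongly Stoltenberg-Cauchy net (indexed by a directed preordered set) is d-convergent. -/
theorem stmt_18 {X : Type*} (d : X → X → ℝ)
    (hd0 : ∀ x y, 0 ≤ d x y) (hdxx : ∀ x, d x x = 0)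
    (htri : ∀ x y z, d x z ≤ d x y + d y z)
    (hsep : ∀ x y, d x y = 0 → d y x = 0 → x = y)
    (τ : TopologicalSpace X)
    (hτ : τ = TopologicalSpace.generateFrom
      {s : Set X | ∃ (x : X) (r : ℝ), 0 < r ∧ s = {y | d x y < r}})
    (hT1 : @T1Space X τ) :
    (∀ u : ℕ → X,
      (∀ ε > (0 : ℝ), ∃ n₀ : ℕ, ∀ k n, n₀ ≤ k → k ≤ n → d (u n) (u k) < ε) →
      ∃ x : X, ∀ ε > (0 : ℝ), ∃ n₀ : ℕ, ∀ n ≥ n₀, d x (u n) < ε) ↔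
    (∀ (I : Type*) (le : I → I → Prop), Reflexive le → Transitive le →
      (∀ i j : I, ∃ k : I, le i k ∧ le j k) → Nonempty I →
      ∀ x : I → X,
      (∀ ε > (0 : ℝ), ∃ i₀ : I, ∀ i j : I, le i₀ i → le i₀ j →
        (le j i ∨ (¬ le i j ∧ ¬ le j i)) → d (x i) (x j) < ε) →
      ∃ a : X, ∀ ε > (0 : ℝ), ∃ i₀ : I, ∀ i : I, le i₀ i → d a (x i) < ε) := by
  constructor
  · intro H I le hrefl htrans hdir _ x hx
    choose f hf using fun n : ℕ => hx (1 / ((n : ℝ) + 1)) (by positivity)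
    obtain ⟨g, hmono, hfg⟩ := exists_monotone_dominating_seq le hrefl htrans hdir f
    have key : ∀ ε > (0 : ℝ), ∃ m, ∀ i j, le (g m) i → le (g m) j →
        (le j i ∨ (¬ le i j ∧ ¬ le j i)) → d (x i) (x j) < ε := by
      intro ε hε
      obtain ⟨m, hm⟩ := exists_nat_one_div_lt hε
      exact ⟨m, fun i j hi hj hij =>
        (hf m i j (htrans (hfg m) hi) (htrans (hfg m) hj) hij).trans hm⟩
    by_cases hS : ∃ s, ∀ n, le (g n) s
    · -- above a common upper bound of the sequence, the net is constant
      obtain ⟨s, hs⟩ := hS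
      refine ⟨x s, fun ε hε => ⟨s, fun i hi => ?_⟩⟩
      have hzero : d (x i) (x s) = 0 := by
        refine le_antisymm (le_of_forall_pos_lt_add fun δ hδ => ?_) (hd0 _ _)
        obtain ⟨m, hm⟩ := key δ hδ
        simpa using hm i s (htrans (hs m) hi) (hs m) (Or.inl hi)
      rw [eq_of_quasiMetric_eq_zero d htri τ hτ hT1 hzero, hdxx]
      exact hε
    · push Not at hS
      obtain ⟨a, ha⟩ := H (fun n => x (g n)) fun ε hε => by
        obtain ⟨m, hm⟩ := key ε hε
        exact ⟨m, fun k n hk hkn => hm _ _ (hmono _ _ (hk.trans hkn)) (hmono _ _ hk)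
          (Or.inl (hmono _ _ hkn))⟩
      refine ⟨a, fun ε hε => ?_⟩
      obtain ⟨m, hm⟩ := key (ε / 2) (half_pos hε)
      obtain ⟨p, hp⟩ := ha (ε / 2) (half_pos hε)
      refine ⟨g m, fun i hi => ?_⟩
      obtain ⟨q, hq⟩ := hS i
      let n := max m (max p q)
      have hmn : m ≤ n := le_max_left _ _
      have hpn : p ≤ n := (le_max_left p q).trans (le_max_right _ _)
      have hqn : q ≤ n := (le_max_right p q).trans (le_max_right _ _)
      have hn : ¬ le (g n) i := fun h => hq (htrans (hmono _ _ hqn) h)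
      have hni : d (x (g n)) (x i) < ε / 2 := hm _ _ (hmono _ _ hmn) hi (by tauto)
      have han := hp n hpn
      have := htri a (x (g n)) (x i)
      linarith
  · intro H u hu
    obtain ⟨a, ha⟩ := H (ULift ℕ) (fun i j => i.down ≤ j.down) (fun _ => le_rfl)
      (fun _ _ _ => le_trans) (fun i j => ⟨⟨max i.down j.down⟩, le_max_left _ _, le_max_right _ _⟩)
      ⟨⟨0⟩⟩ (fun i => u i.down) fun ε hε => by
        obtain ⟨m, hm⟩ := hu ε hε
        exact ⟨⟨m⟩, fun i j _ hj hij => hm _ _ hj (by omega)⟩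
    refine ⟨a, fun ε hε => ?_⟩
    obtain ⟨m, hm⟩ := ha ε hε
    exact ⟨m.down, fun n hn => hm ⟨n⟩ hn⟩
end

section
/- Let (X,d) be a T1 quasi-metric space in which every right K-Cauchy sequence is d-convergent, let (I,≤) be a directed preordered set having no maximal elements, and let (x_i : i ∈ I) be a net in X such that for every ε > 0 there exists i_ε ∈ I with d(x_i,x_j) < ε for all i,j ≥ i_ε with i ≰ j. Then the net (x_i) is d-convergent. -/
/-- In a directed preordered set without maximal elements, every sequence is dominated by a
strictly increasing one. -/
theorem exists_strictly_increasing_dominating {I : Type*} (le : I → I → Prop)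
    (hrefl : ∀ i, le i i) (htrans : ∀ ⦃i j k⦄, le i j → le j k → le i k)
    (hdir : ∀ i j : I, ∃ k : I, le i k ∧ le j k)
    (hnomax : ¬ ∃ j : I, ∀ i : I, le j i → le i j) (c : ℕ → I) :
    ∃ s : ℕ → I, (∀ n, le (c n) (s n)) ∧ (∀ k n, k ≤ n → le (s k) (s n)) ∧
      ∀ k n, k < n → ¬ le (s n) (s k) := by
  have hstep : ∀ (n : ℕ) (j : I), ∃ k, le j k ∧ le (c n) k ∧ ¬ le k j := by
    intro n j
    push Not at hnomax
    obtain ⟨i, hji, hij⟩ := hnomax j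
    obtain ⟨k, hik, hck⟩ := hdir i (c n)
    exact ⟨k, htrans hji hik, hck, fun h => hij (htrans hik h)⟩
  choose f hf₁ hf₂ hf₃ using hstep
  let s : ℕ → I := fun n => Nat.rec (c 0) (fun m j => f (m + 1) j) n
  have hmono : ∀ k n, k ≤ n → le (s k) (s n) := by
    intro k n hkn
    induction hkn with
    | refl => exact hrefl _
    | step _ ih => exact htrans ih (hf₁ _ _)
  refine ⟨s, ?_, hmono, fun k n hkn h => ?_⟩
  · rintro (_ | n)
    · exact hrefl _
    · exact hf₂ _ _
  · exact hf₃ (k + 1) (s k) (htrans (hmono (k + 1) n hkn) h)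

/-- Gregori–Ferrer: In a T1 quasi-metric space in which every right
K-Cauchy sequence is d-convergent, every net indexed by a directed preordered set
without maximal elements and satisfying Stoltenberg's Cauchy condition is d-convergent. -/
theorem stmt_19 {X : Type*} (d : X → X → ℝ)
    (hd0 : ∀ x y, 0 ≤ d x y) (hdxx : ∀ x, d x x = 0)
    (htri : ∀ x y z, d x z ≤ d x y + d y z)
    (hsep : ∀ x y, d x y = 0 → d y x = 0 → x = y)
    (τ : TopologicalSpace X)
    (hτ : τ = TopologicalSpace.generateFrom
      {s : Set X | ∃ (x : X) (r : ℝ), 0 < r ∧ s = {y | d x y < r}})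
    (hT1 : @T1Space X τ)
    (hcompl : ∀ u : ℕ → X,
      (∀ ε > (0 : ℝ), ∃ n₀ : ℕ, ∀ k n, n₀ ≤ k → k ≤ n → d (u n) (u k) < ε) →
      ∃ x : X, ∀ ε > (0 : ℝ), ∃ n₀ : ℕ, ∀ n ≥ n₀, d x (u n) < ε)
    {I : Type*} (le : I → I → Prop)
    (hrefl : Reflexive le) (htrans : Transitive le)
    (hdir : ∀ i j : I, ∃ k : I, le i k ∧ le j k) (hne : Nonempty I)
    (hnomax : ¬ ∃ j : I, ∀ i : I, le j i → le i j)
    (x : I → X)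
    (hC : ∀ ε > (0 : ℝ), ∃ iε : I, ∀ i j : I, le iε i → le iε j → ¬ le i j →
      d (x i) (x j) < ε) :
    ∃ a : X, ∀ ε > (0 : ℝ), ∃ i₀ : I, ∀ i : I, le i₀ i → d a (x i) < ε := by
  choose c hc using fun n : ℕ => hC (1 / ((n : ℝ) + 1)) Nat.one_div_pos_of_nat
  obtain ⟨s, hcs, hmono, hstrict⟩ :=
    exists_strictly_increasing_dominating le hrefl htrans hdir hnomax c
  have hlt : ∀ ε > (0 : ℝ), ∃ N, ∀ i j, le (s N) i → le (s N) j → ¬ le i j →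
      d (x i) (x j) < ε := by
    intro ε hε
    obtain ⟨N, hN⟩ := exists_nat_one_div_lt hε
    exact ⟨N, fun i j hi hj hij =>
      (hc N i j (htrans (hcs N) hi) (htrans (hcs N) hj) hij).trans hN⟩
  by_cases hbdd : ∃ i, ∀ n, le (s n) i
  · obtain ⟨i, hi⟩ := hbdd
    have heq : ∀ k j, (∀ n, le (s n) k) → (∀ n, le (s n) j) → ¬ le k j → x k = x j := by
      intro k j hk hj hkj
      refine eq_of_quasiMetric_eq_zero d htri τ hτ hT1 (le_antisymm ?_ (hd0 _ _))
      refine le_of_forall_pos_lt_add fun ε hε => ?_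
      obtain ⟨N, hN⟩ := hlt ε hε
      simpa using hN k j (hk N) (hj N) hkj
    refine ⟨x i, fun ε hε => ⟨i, fun j hij => ?_⟩⟩
    push Not at hnomax
    obtain ⟨k, hjk, hkj⟩ := hnomax j
    have hj : ∀ n, le (s n) j := fun n => htrans (hi n) hij
    have hk : ∀ n, le (s n) k := fun n => htrans (hj n) hjk
    rw [← heq k i hk hi fun h => hkj (htrans h hij), heq k j hk hj hkj, hdxx]
    exact hε
  · push Not at hbdd
    obtain ⟨a, ha⟩ := hcompl (fun n => x (s n)) (by
      intro ε hε
      obtain ⟨N, hN⟩ := hlt ε hε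
      refine ⟨N, fun k n hk hkn => ?_⟩
      rcases hkn.eq_or_lt with rfl | hkn'
      · simpa only [hdxx] using hε
      · exact hN _ _ (hmono N n (hk.trans hkn)) (hmono N k hk) (hstrict k n hkn'))
    refine ⟨a, fun ε hε => ?_⟩
    obtain ⟨M, hM⟩ := ha (ε / 2) (half_pos hε)
    obtain ⟨N, hN⟩ := hlt (ε / 2) (half_pos hε)
    refine ⟨s (max M N), fun i hi => ?_⟩
    obtain ⟨n, hn⟩ := hbdd i
    have hle : max M N ≤ n := by
      by_contra! h
      exact hn (htrans (hmono n _ h.le) hi)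
    have h₁ := hM n ((le_max_left M N).trans hle)
    have h₂ := hN (s n) i (hmono N n ((le_max_right M N).trans hle))
      (htrans (hmono N _ (le_max_right M N)) hi) hn
    have h₃ := htri a (x (s n)) (x i)
    linarith
end
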